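/- Let A : Matrix (Fin N) (Fin N) ℝ be invertible with N ≥ 1. Then the smallest singular value satisfies σ_min(A) ≥ 1 / (√(‖A⁻¹‖_∞) · √(‖A⁻¹‖₁)); that is, for every x ∈ ℝ^N with Euclidean norm ‖x‖ = 1, one has ‖A.mulVec x‖ ≥ 1 / √(‖A⁻¹‖_∞ · ‖A⁻¹‖₁). -/

import Mathlib

/-- Euclidean norm of a vector in ℝ^N. -/
noncomputable def euclNorm {N : ℕ} (x : Fin N → ℝ) : ℝ :=
  ‖(WithLp.equiv 2 (Fin N → ℝ)).symm x‖

/-- Smallest singular value: infimum of ‖A x‖ over unit vectors x (Euclidean norm). -/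
noncomputable def sigmaMin {N : ℕ} (A : Matrix (Fin N) (Fin N) ℝ) : ℝ :=
  sInf {r : ℝ | ∃ x : Fin N → ℝ, euclNorm x = 1 ∧ r = euclNorm (A.mulVec x)}

/-- Maximum absolute row sum (ℓ∞→ℓ∞ operator norm) of a real square matrix. -/
noncomputable def maxRowSum {N : ℕ} (A : Matrix (Fin N) (Fin N) ℝ) : ℝ :=
  ⨆ i, ∑ j, |A i j|

/-- Maximum absolute column sum (ℓ1→ℓ1 operator norm) of a real square matrix. -/
noncomputable def maxColSum {N : ℕ} (A : Matrix (Fin N) (Fin N) ℝ) : ℝ :=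
  ⨆ j, ∑ i, |A i j|

theorem euclNorm_sq_eq {N : ℕ} (x : Fin N → ℝ) : euclNorm x ^ 2 = ∑ i, x i ^ 2 := by
  unfold euclNorm
  rw [EuclideanSpace.norm_sq_eq]
  simp

theorem euclNorm_nonneg' {N : ℕ} (x : Fin N → ℝ) : 0 ≤ euclNorm x := norm_nonneg _

theorem schur_row_le {N : ℕ} (B : Matrix (Fin N) (Fin N) ℝ) (i : Fin N) :
    ∑ j, |B i j| ≤ maxRowSum B :=
  le_ciSup (f := fun i => ∑ j, |B i j|) (Set.finite_range _).bddAbove i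

theorem schur_col_le {N : ℕ} (B : Matrix (Fin N) (Fin N) ℝ) (j : Fin N) :
    ∑ i, |B i j| ≤ maxColSum B :=
  le_ciSup (f := fun j => ∑ i, |B i j|) (Set.finite_range _).bddAbove j

theorem schur_row_nonneg {N : ℕ} (B : Matrix (Fin N) (Fin N) ℝ) : 0 ≤ maxRowSum B :=
  Real.iSup_nonneg fun _ => Finset.sum_nonneg fun _ _ => abs_nonneg _

/-- The Schur test. -/
theorem schur_test {N : ℕ} (B : Matrix (Fin N) (Fin N) ℝ) (y : Fin N → ℝ) :
    euclNorm (B.mulVec y) ^ 2 ≤ maxRowSum B * maxColSum B * euclNorm y ^ 2 := by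
  rw [euclNorm_sq_eq, euclNorm_sq_eq]
  have h1 : ∀ i, (B.mulVec y i) ^ 2 ≤ maxRowSum B * ∑ j, |B i j| * y j ^ 2 := by
    intro i
    have h := Finset.sum_sq_le_sum_mul_sum_of_sq_eq_mul Finset.univ
      (r := fun j => B i j * y j) (f := fun j => |B i j|) (g := fun j => |B i j| * y j ^ 2)
      (fun j _ => abs_nonneg _) (fun j _ => by positivity)
      (fun j _ => by rw [← mul_assoc, abs_mul_abs_self]; ring)
    refine le_trans h ?_
    exact mul_le_mul_of_nonneg_right (schur_row_le B i)
      (Finset.sum_nonneg fun j _ => by positivity)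
  calc ∑ i, (B.mulVec y i) ^ 2 ≤ ∑ i, maxRowSum B * ∑ j, |B i j| * y j ^ 2 :=
        Finset.sum_le_sum fun i _ => h1 i
    _ = maxRowSum B * ∑ j, (∑ i, |B i j|) * y j ^ 2 := by
        rw [← Finset.mul_sum, Finset.sum_comm]
        simp_rw [Finset.sum_mul]
    _ ≤ maxRowSum B * ∑ j, maxColSum B * y j ^ 2 := by
        refine mul_le_mul_of_nonneg_left ?_ (schur_row_nonneg B)
        exact Finset.sum_le_sum fun j _ =>
          mul_le_mul_of_nonneg_right (schur_col_le B j) (sq_nonneg _)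
    _ = _ := by rw [← Finset.mul_sum, mul_assoc]

theorem sigmaMin_ge_inv_sqrt_inverse_norms
    (N : ℕ) (hN : 1 ≤ N) (A : Matrix (Fin N) (Fin N) ℝ) (hA : IsUnit A.det) :
    sigmaMin A ≥ 1 / (Real.sqrt (maxRowSum A⁻¹) * Real.sqrt (maxColSum A⁻¹)) ∧
      ∀ x : Fin N → ℝ, euclNorm x = 1 →
        euclNorm (A.mulVec x) ≥ 1 / Real.sqrt (maxRowSum A⁻¹ * maxColSum A⁻¹) := by
  have key : ∀ x : Fin N → ℝ, euclNorm x = 1 →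
      euclNorm (A.mulVec x) ≥ 1 / Real.sqrt (maxRowSum A⁻¹ * maxColSum A⁻¹) := by
    intro x hx
    have h := schur_test A⁻¹ (A.mulVec x)
    rw [Matrix.mulVec_mulVec, Matrix.nonsing_inv_mul A hA, Matrix.one_mulVec, hx] at h
    have hp : 0 < maxRowSum A⁻¹ * maxColSum A⁻¹ := by
      by_contra hc
      nlinarith [sq_nonneg (euclNorm (A.mulVec x))]
    have hs := Real.sqrt_pos.mpr hp
    rw [ge_iff_le, div_le_iff₀ hs]
    refine (pow_le_pow_iff_left₀ zero_le_one (mul_nonneg (euclNorm_nonneg' _) hs.le) two_ne_zero).mp ?_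
    rw [mul_pow, Real.sq_sqrt hp.le]
    linarith
  refine ⟨?_, key⟩
  rw [← Real.sqrt_mul (schur_row_nonneg _)]
  refine le_csInf ?_ ?_
  · refine ⟨_, Pi.single ⟨0, hN⟩ 1, ?_, rfl⟩
    have h : euclNorm (Pi.single (⟨0, hN⟩ : Fin N) (1 : ℝ)) ^ 2 = 1 := by
      rw [euclNorm_sq_eq, Finset.sum_eq_single ⟨0, hN⟩]
      · simp
      · intro b _ hb
        simp [hb]
      · simp
    exact (pow_eq_one_iff_of_nonneg (euclNorm_nonneg' _) two_ne_zero).mp h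
  · rintro r ⟨x, hx, rfl⟩
    exact key x hx
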